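/- arXiv:math/9908141 — 4 statements merged into one kernel-verified Lean document; each statement's English description precedes it below -/
import Mathlib

section
/- For every real α > -1, every real M, every integer n ≥ 0 and every real x, the generalized Laguerre polynomial y = L_n^{α,M} satisfies the differential equation M·[a_0(n,α)·y(x) + Σ_{i=1}^∞ a_i(α,x)·y^{(i)}(x)] + x·y''(x) + (α+1−x)·y'(x) + n·y(x) = 0, where a_0(n,α) = C(n+α+1, n−1); the infinite sum has only finitely many nonzero terms because y is a polynomial of degree n. -/
open Finset

/-- Generalized binomial coefficient `C(z, k)` for real `z` and integer `k`,
equal to `z (z-1) ⋯ (z-k+1) / k!` for `k ≥ 0` and `0` for `k < 0`. -/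
noncomputable def gbinom (z : ℝ) (k : ℤ) : ℝ :=
  if 0 ≤ k then (∏ j ∈ Finset.range k.toNat, (z - (j : ℝ))) / (Nat.factorial k.toNat : ℝ)
  else 0

/-- Pochhammer symbol `(z)_k = z (z+1) ⋯ (z+k-1)`. -/
noncomputable def poch (z : ℝ) (k : ℕ) : ℝ :=
  ∏ j ∈ Finset.range k, (z + (j : ℝ))

/-- Classical Laguerre polynomial `L_n^α(x) = ∑_{k=0}^n (-1)^k C(n+α, n-k) x^k / k!`. -/
noncomputable def laguerre (α : ℝ) (n : ℕ) (x : ℝ) : ℝ :=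
  ∑ k ∈ Finset.range (n + 1),
    (-1 : ℝ) ^ k * gbinom ((n : ℝ) + α) ((n : ℤ) - (k : ℤ)) * x ^ k / (Nat.factorial k : ℝ)

/-- The coefficient functions `a_i(α, x)` for `i ≥ 1`. -/
noncomputable def aFun (α : ℝ) (i : ℕ) (x : ℝ) : ℝ :=
  (1 / (Nat.factorial i : ℝ)) * ∑ j ∈ Finset.Icc 1 i,
    (-1 : ℝ) ^ (i + j + 1) * gbinom (α + 1) ((j : ℤ) - 1) *
      gbinom (α + 2) ((i : ℤ) - (j : ℤ)) * poch (α + 3) (i - j) * x ^ j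

/-- Koornwinder generalized Laguerre polynomial `L_n^{α,M}`. -/
noncomputable def koornLaguerre (α M : ℝ) (n : ℕ) (x : ℝ) : ℝ :=
  (1 + M * gbinom ((n : ℝ) + α) ((n : ℤ) - 1)) * laguerre α n x
    + M * gbinom ((n : ℝ) + α) (n : ℤ) * deriv (laguerre α n) x

lemma gbinom_natCast (z : ℝ) (k : ℕ) :
    gbinom z (k : ℤ) = (∏ j ∈ range k, (z - (j : ℝ))) / (k.factorial : ℝ) := by
  simp [gbinom]

lemma gbinom_eq_ringChoose (z : ℝ) (k : ℕ) : gbinom z (k : ℤ) = Ring.choose z k := by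
  rw [gbinom_natCast, Ring.choose_eq_smul, ← descPochhammer_eval_eq_prod_range,
    Polynomial.eval_eq_smeval, smul_eq_mul, div_eq_inv_mul]
  congr 1
  rw [← descPochhammer_map (Int.castRingHom ℝ) k, ← Polynomial.eval_eq_smeval,
    Polynomial.eval_map, ← Polynomial.eval₂_smulOneHom_eq_smeval]
  congr 1
  exact RingHom.ext_int _ _

lemma gbinom_of_neg (z : ℝ) {k : ℤ} (hk : k < 0) : gbinom z k = 0 := by
  simp [gbinom, not_le.mpr hk]

/-- Chu–Vandermonde identity for generalized binomial coefficients. -/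
lemma sum_choose_mul_gbinom (N d : ℕ) (w : ℝ) :
    ∑ b ∈ range (d + 1), (N.choose (d - b) : ℝ) * gbinom w b = gbinom (N + w) d := by
  rw [gbinom_eq_ringChoose, add_comm (N : ℝ), Ring.add_choose_eq _ (Commute.all _ _),
    Nat.sum_antidiagonal_eq_sum_range_succ (fun i j => Ring.choose w i * Ring.choose (N : ℝ) j)]
  refine sum_congr rfl fun b _ => ?_
  rw [gbinom_eq_ringChoose, Ring.choose_natCast, mul_comm]

lemma sum_choose_mul_gbinom_sub (n r : ℕ) (w : ℝ) :
    ∑ k ∈ range (n + 1), (n.choose k : ℝ) * gbinom w ((k : ℤ) - r)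
      = gbinom (n + w) ((n : ℤ) - r) := by
  rcases lt_or_ge n r with h | h
  · rw [gbinom_of_neg _ (by omega)]
    refine sum_eq_zero fun k hk => ?_
    rw [gbinom_of_neg _ (by rw [mem_range] at hk; omega), mul_zero]
  · obtain ⟨d, rfl⟩ := Nat.exists_eq_add_of_le h
    rw [add_assoc, sum_range_add, sum_eq_zero, zero_add, show ((r + d : ℕ) : ℤ) - r = d by simp,
      ← sum_choose_mul_gbinom]
    · refine sum_congr rfl fun b hb => ?_
      rw [mem_range] at hb
      rw [← Nat.choose_symm_of_eq_add (show r + d = r + b + (d - b) by omega)]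
      simp
    · intro k hk
      rw [gbinom_of_neg _ (by rw [mem_range] at hk; omega), mul_zero]

lemma intCast_mul_gbinom (w : ℝ) (t : ℤ) :
    (t : ℝ) * gbinom (w + 1) t = (w + 1) * gbinom w (t - 1) := by
  rcases lt_trichotomy t 0 with h | rfl | h
  · simp [gbinom_of_neg _ h, gbinom_of_neg _ (show t - 1 < 0 by omega)]
  · simp [gbinom_of_neg]
  · obtain ⟨s, rfl⟩ : ∃ s : ℕ, t = (s + 1 : ℕ) := ⟨(t - 1).toNat, by omega⟩
    rw [show ((s + 1 : ℕ) : ℤ) - 1 = s by simp, gbinom_natCast, gbinom_natCast, prod_range_succ',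
      Nat.factorial_succ]
    have h : ∀ j : ℕ, w + 1 - ((j + 1 : ℕ) : ℝ) = w - j := fun j => by push_cast; ring
    simp only [h]
    push_cast
    have : (s : ℝ) + 1 ≠ 0 := by positivity
    have : (s.factorial : ℝ) ≠ 0 := by positivity
    field_simp
    ring

lemma poch_succ (z : ℝ) (k : ℕ) : poch z (k + 1) = poch z k * (z + k) := by
  simp [poch, prod_range_succ]

lemma mul_poch_add_one (z : ℝ) (k : ℕ) : z * poch (z + 1) k = poch z k * (z + k) := by
  rw [← poch_succ, poch, poch, prod_range_succ', mul_comm]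
  congr 1
  · exact prod_congr rfl fun j _ => by push_cast; ring
  · simp

lemma poch_pos {z : ℝ} (hz : 0 < z) (k : ℕ) : 0 < poch z k :=
  prod_pos fun _ _ => by positivity

lemma poch_mul_gbinom_add (α : ℝ) (k d : ℕ) :
    poch (α + 1) k * gbinom ((k + d : ℕ) + α) d = poch (α + 1) (k + d) / d.factorial := by
  rw [gbinom_natCast, poch, poch, prod_range_add, mul_div_assoc,
    ← prod_range_reflect (fun j => ((k + d : ℕ) : ℝ) + α - (j : ℝ))]
  congr 2
  refine prod_congr rfl fun j hj => ?_
  rw [mem_range] at hj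
  rw [Nat.sub_sub, Nat.cast_sub (by omega)]
  push_cast
  ring

lemma gbinom_add_sub {α : ℝ} (hα : -1 < α) {n k : ℕ} (h : k ≤ n) :
    gbinom (n + α) ((n : ℤ) - k) = poch (α + 1) n / (poch (α + 1) k * (n - k).factorial) := by
  obtain ⟨d, rfl⟩ := Nat.exists_eq_add_of_le h
  have hp := (poch_pos (show 0 < α + 1 by linarith) k).ne'
  rw [show ((k + d : ℕ) : ℤ) - k = d by simp, Nat.add_sub_cancel_left, ← div_div,
    div_right_comm, ← poch_mul_gbinom_add, mul_div_cancel_left₀ _ hp]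

/-- Coefficient of `x ^ r` in `∑ i ≥ 1, a_i(α, x) (x ^ k)^{(i)}`. -/
noncomputable def monomialImageCoeff (α : ℝ) (k r : ℕ) : ℝ :=
  (-1) ^ (k + r + 1) * (poch (α + 2) k / (α + 2)) * gbinom (α + 2) ((k : ℤ) - r)
    * (r / r.factorial)

lemma aFun_succ (α : ℝ) (i : ℕ) (x : ℝ) :
    aFun α (i + 1) x = 1 / ((i + 1).factorial : ℝ) * ∑ m ∈ range (i + 1),
      (-1) ^ (m + 1) * gbinom (α + 1) (i - m : ℕ) * gbinom (α + 2) m * poch (α + 3) m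
        * x ^ (i - m + 1) := by
  rw [aFun]
  congr 1
  refine sum_nbij' (fun j => i + 1 - j) (fun m => i + 1 - m) ?_ ?_ ?_ ?_ ?_
  · intro j hj; rw [mem_Icc] at hj; rw [mem_range]; omega
  · intro m hm; rw [mem_range] at hm; rw [mem_Icc]; omega
  · intro j hj; rw [mem_Icc] at hj; omega
  · intro m hm; rw [mem_range] at hm; omega
  · intro j hj
    rw [mem_Icc] at hj
    obtain ⟨m, hm⟩ := Nat.exists_eq_add_of_le hj.2
    obtain ⟨b, rfl⟩ := Nat.exists_eq_add_of_le hj.1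
    obtain rfl : i = b + m := by omega
    have hsign : (-1 : ℝ) ^ (b + m + 1 + (1 + b) + 1) = (-1) ^ (m + 1) := by
      rw [show b + m + 1 + (1 + b) + 1 = 2 * (b + 1) + (m + 1) by ring, pow_add, pow_mul]
      simp
    rw [hsign, show b + m + 1 - (1 + b) = m by omega, show b + m - m = b by omega,
      show ((1 + b : ℕ) : ℤ) - 1 = b by push_cast; ring,
      show ((b + m + 1 : ℕ) : ℤ) - (1 + b : ℕ) = m by push_cast; ring, add_comm 1 b]

lemma monomialImageCoeff_eq {α : ℝ} (hα : -1 < α) (m d : ℕ) :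
    monomialImageCoeff α (m + d + 1) (d + 1)
      = (-1) ^ (m + 1) * gbinom (α + 2) m * poch (α + 3) m
        * gbinom ((m + d + 1 : ℕ) + (α + 1)) d := by
  have hα2 : α + 2 ≠ 0 := by linarith
  have hd : (d.factorial : ℝ) ≠ 0 := by positivity
  have hd1 : (d : ℝ) + 1 ≠ 0 := by positivity
  have hp := poch_mul_gbinom_add (α + 2) m d
  have hq := mul_poch_add_one (α + 2) (m + d)
  rw [← poch_succ] at hq
  rw [show α + 2 + 1 = α + 3 by ring] at hp hq
  have hsign : (-1 : ℝ) ^ (m + d + 1 + (d + 1) + 1) = (-1) ^ (m + 1) := by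
    rw [show m + d + 1 + (d + 1) + 1 = 2 * (d + 1) + (m + 1) by ring, pow_add, pow_mul]
    simp
  rw [monomialImageCoeff, hsign, ← hq, mul_div_cancel_left₀ _ hα2, Nat.factorial_succ,
    show ((m + d + 1 : ℕ) : ℤ) - (d + 1 : ℕ) = m by push_cast; ring,
    show ((m + d + 1 : ℕ) : ℝ) + (α + 1) = (m + d : ℕ) + (α + 2) by push_cast; ring,
    mul_assoc _ (poch (α + 3) m), hp]
  push_cast
  field_simp

lemma monomialImageCoeff_of_lt (α : ℝ) {k r : ℕ} (h : k < r) : monomialImageCoeff α k r = 0 := by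
  rw [monomialImageCoeff, gbinom_of_neg _ (by omega)]
  ring

lemma monomialImageCoeff_zero_right (α : ℝ) (k : ℕ) : monomialImageCoeff α k 0 = 0 := by
  simp [monomialImageCoeff]

/-- The operator `∑ i ≥ 1, a_i(α, x) ∂^i` applied to `x ^ k`. -/
lemma sum_aFun_mul_descFactorial {α : ℝ} (hα : -1 < α) {k N : ℕ} (hk : k ≤ N) (x : ℝ) :
    ∑ i ∈ range N, aFun α (i + 1) x * (k.descFactorial (i + 1) * x ^ (k - (i + 1)))
      = ∑ r ∈ range (N + 1), monomialImageCoeff α k r * x ^ r := by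
  rw [sum_range_succ', monomialImageCoeff_zero_right, zero_mul, add_zero,
    ← sum_subset (range_mono hk), ← sum_subset (range_mono hk)]
  · let F : ℕ → ℕ → ℝ := fun m b => (-1) ^ (m + 1) * gbinom (α + 2) m * poch (α + 3) m
      * x ^ (k - m) * (k.choose (m + b + 1) * gbinom (α + 1) b)
    trans ∑ i ∈ range k, ∑ m ∈ range (i + 1), F m (i - m)
    · refine sum_congr rfl fun i hi => ?_
      rw [mem_range] at hi
      rw [aFun_succ, mul_sum, sum_mul]
      refine sum_congr rfl fun m hm => ?_
      rw [mem_range] at hm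
      have hf : ((i + 1).factorial : ℝ) ≠ 0 := by positivity
      rw [Nat.descFactorial_eq_factorial_mul_choose]
      simp only [F]
      rw [show m + (i - m) + 1 = i + 1 by omega,
        show k - m = (i - m + 1) + (k - (i + 1)) by omega,
        pow_add x (i - m + 1) (k - (i + 1))]
      push_cast
      field_simp
    · rw [sum_range_diag_flip, ← sum_range_reflect (n := k)]
      refine sum_congr rfl fun d hd => ?_
      rw [mem_range] at hd
      obtain ⟨m, rfl⟩ : ∃ m, k = m + d + 1 := ⟨k - (d + 1), by omega⟩
      simp only [F]
      rw [show m + d + 1 - 1 - d = m by omega, show m + d + 1 - m = d + 1 by omega,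
        monomialImageCoeff_eq hα, ← sum_choose_mul_gbinom, ← mul_sum, mul_right_comm]
      congr 2
      refine sum_congr rfl fun b hb => ?_
      rw [mem_range] at hb
      rw [← Nat.choose_symm_of_eq_add (show m + d + 1 = (m + b + 1) + (d - b) by omega)]
  · intro r _ hr
    rw [mem_range] at hr
    rw [monomialImageCoeff_of_lt _ (by omega), zero_mul]
  · intro i _ hi
    rw [mem_range] at hi
    rw [Nat.descFactorial_of_lt (by omega)]
    simp

lemma iteratedDeriv_sum_monomials (c : ℕ → ℝ) (N i : ℕ) (x : ℝ) :
    iteratedDeriv i (fun t => ∑ k ∈ range N, c k * t ^ k) x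
      = ∑ k ∈ range N, c k * (k.descFactorial i * x ^ (k - i)) := by
  rw [iteratedDeriv_fun_sum (fun k _ => by fun_prop)]
  refine sum_congr rfl fun k _ => ?_
  rw [iteratedDeriv_const_mul_field, iteratedDeriv_pow]

lemma deriv_sum_monomials (c : ℕ → ℝ) {N : ℕ} (hc : c (N + 1) = 0) (x : ℝ) :
    deriv (fun t => ∑ k ∈ range (N + 1), c k * t ^ k) x
      = ∑ k ∈ range (N + 1), (k + 1) * c (k + 1) * x ^ k := by
  rw [← iteratedDeriv_one, iteratedDeriv_sum_monomials, sum_range_succ', sum_range_succ, hc]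
  simp only [Nat.descFactorial_one, Nat.add_sub_cancel, Nat.cast_zero, zero_mul, mul_zero, add_zero]
  refine sum_congr rfl fun k _ => ?_
  push_cast
  ring

lemma tsum_aFun_mul_iteratedDeriv {α : ℝ} (hα : -1 < α) (c : ℕ → ℝ) (N : ℕ) (x : ℝ) :
    ∑' i : ℕ, aFun α (i + 1) x
        * iteratedDeriv (i + 1) (fun t => ∑ k ∈ range (N + 1), c k * t ^ k) x
      = ∑ r ∈ range (N + 1), (∑ k ∈ range (N + 1), c k * monomialImageCoeff α k r) * x ^ r := by
  simp only [iteratedDeriv_sum_monomials]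
  rw [tsum_eq_sum (s := range N)]
  · simp only [mul_sum, sum_mul]
    rw [sum_comm]
    conv_rhs => rw [sum_comm]
    refine sum_congr rfl fun k hk => ?_
    rw [mem_range] at hk
    simp only [mul_assoc, ← mul_sum, ← sum_aFun_mul_descFactorial hα (Nat.le_of_lt_succ hk)]
    simp only [mul_sum, mul_left_comm]
  · intro i hi
    rw [mem_range] at hi
    rw [sum_eq_zero, mul_zero]
    intro k hk
    rw [mem_range] at hk
    rw [Nat.descFactorial_of_lt (by omega)]
    simp

/-- Coefficient of `x ^ k` in `laguerre α n x`. -/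
noncomputable def laguerreCoeff (α : ℝ) (n k : ℕ) : ℝ :=
  (-1) ^ k * gbinom (n + α) ((n : ℤ) - k) / k.factorial

lemma laguerre_eq_sum_coeff (α : ℝ) (n : ℕ) :
    laguerre α n = fun t => ∑ k ∈ range (n + 1), laguerreCoeff α n k * t ^ k := by
  funext t
  refine sum_congr rfl fun k _ => ?_
  rw [laguerreCoeff]
  ring

lemma laguerreCoeff_of_lt (α : ℝ) {n k : ℕ} (h : n < k) : laguerreCoeff α n k = 0 := by
  rw [laguerreCoeff, gbinom_of_neg _ (by omega)]
  ring

lemma laguerreCoeff_eq {α : ℝ} (hα : -1 < α) {n k : ℕ} (h : k ≤ n) :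
    laguerreCoeff α n k
      = (-1) ^ k * poch (α + 1) n / (poch (α + 1) k * (n - k).factorial * k.factorial) := by
  rw [laguerreCoeff, gbinom_add_sub hα h]
  field_simp

lemma laguerreCoeff_succ {α : ℝ} (hα : -1 < α) (n k : ℕ) :
    laguerreCoeff α n (k + 1)
      = -((n - k) / ((k + 1) * (α + 1 + k))) * laguerreCoeff α n k := by
  rcases lt_trichotomy n k with h | rfl | h
  · simp [laguerreCoeff_of_lt α h, laguerreCoeff_of_lt α (Nat.lt_succ_of_lt h)]
  · simp [laguerreCoeff_of_lt α (Nat.lt_succ_self n)]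
  · obtain ⟨d, rfl⟩ := Nat.exists_eq_add_of_lt h
    rw [laguerreCoeff_eq hα (show k + 1 ≤ k + d + 1 by omega), laguerreCoeff_eq hα h.le,
      poch_succ _ k,
      show k + d + 1 - (k + 1) = d by omega, show k + d + 1 - k = d + 1 by omega,
      Nat.factorial_succ, Nat.factorial_succ]
    have h1 := (poch_pos (show 0 < α + 1 by linarith) k).ne'
    have h2 : α + 1 + k ≠ 0 := by have : (0 : ℝ) ≤ k := k.cast_nonneg; linarith
    push_cast
    field_simp
    ring

lemma mul_mul_poch_add_three (α : ℝ) (n : ℕ) :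
    (α + 1) * (α + 2) * poch (α + 3) n = poch (α + 1) n * (α + 1 + n) * (α + 2 + n) := by
  have h1 := mul_poch_add_one (α + 1) n
  have h2 := mul_poch_add_one (α + 2) n
  rw [show α + 1 + 1 = α + 2 by ring] at h1
  rw [show α + 2 + 1 = α + 3 by ring] at h2
  linear_combination (α + 1) * h2 + (α + 2 + n) * h1

lemma gbinom_add_two_sub {α : ℝ} (hα : -1 < α) {n r : ℕ} (h : r ≤ n) :
    gbinom (n + (α + 2)) ((n : ℤ) - r)
      = (-1) ^ r * r.factorial * ((α + 1 + n) * (α + 2 + n) / ((α + 1 + r) * (α + 2 + r)))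
        * laguerreCoeff α n r := by
  have hr0 : (0 : ℝ) ≤ r := r.cast_nonneg
  have h1 := (poch_pos (show 0 < α + 1 by linarith) r).ne'
  have hn := mul_mul_poch_add_three α n
  have hr := mul_mul_poch_add_three α r
  have ha1 : α + 1 ≠ 0 := by linarith
  have ha2 : α + 2 ≠ 0 := by linarith
  have hb1 : α + 1 + r ≠ 0 := by linarith
  have hb2 : α + 2 + r ≠ 0 := by linarith
  rw [gbinom_add_sub (by linarith) h, laguerreCoeff_eq hα h, show α + 2 + 1 = α + 3 by ring]
  rw [mul_comm, ← eq_div_iff (mul_ne_zero ha1 ha2)] at hn hr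
  have hs : ((-1 : ℝ) ^ r) * (-1) ^ r = 1 := by rw [← mul_pow]; simp
  rw [hn, hr]
  generalize (-1 : ℝ) ^ r = s at hs ⊢
  field_simp
  rw [sq, hs]
  ring

lemma gbinom_add_one_sub_succ {α : ℝ} (hα : -1 < α) {n r : ℕ} (h : r ≤ n) :
    gbinom (n + (α + 1)) ((n : ℤ) - (r + 1 : ℕ))
      = (-1) ^ r * r.factorial * ((n - r) * (α + 1 + n) / ((α + 1 + r) * (α + 2 + r)))
        * laguerreCoeff α n r := by
  rcases h.eq_or_lt with rfl | h
  · rw [gbinom_of_neg _ (by omega)]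
    ring
  · obtain ⟨d, rfl⟩ := Nat.exists_eq_add_of_lt h
    have hr0 : (0 : ℝ) ≤ r := r.cast_nonneg
    have h1 := (poch_pos (show 0 < α + 1 by linarith) r).ne'
    have hn := mul_poch_add_one (α + 1) (r + d + 1)
    have hr := mul_poch_add_one (α + 1) r
    have ha1 : α + 1 ≠ 0 := by linarith
    have hb1 : α + 1 + r ≠ 0 := by linarith
    have hb2 : α + 2 + r ≠ 0 := by linarith
    rw [show α + 1 + 1 = α + 2 by ring, mul_comm, ← eq_div_iff ha1] at hn hr
    have hs : ((-1 : ℝ) ^ r) * (-1) ^ r = 1 := by rw [← mul_pow]; simp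
    rw [gbinom_add_sub (by linarith) (show r + 1 ≤ r + d + 1 by omega), laguerreCoeff_eq hα h.le,
      show α + 1 + 1 = α + 2 by ring, poch_succ _ r, hn, hr,
      show r + d + 1 - (r + 1) = d by omega, show r + d + 1 - r = d + 1 by omega,
      Nat.factorial_succ]
    push_cast
    generalize (-1 : ℝ) ^ r = s at hs ⊢
    field_simp
    rw [sq, hs]
    ring

lemma laguerreCoeff_mul_monomialImageCoeff {α : ℝ} (hα : -1 < α) {n k : ℕ} (h : k ≤ n) (r : ℕ) :
    laguerreCoeff α n k * monomialImageCoeff α k r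
      = (-1) ^ (r + 1) * laguerreCoeff α n 0 / ((α + 1) * (α + 2)) * (r / r.factorial)
        * (n.choose k * ((α + 1 + k) * gbinom (α + 2) ((k : ℤ) - r))) := by
  have h1 := (poch_pos (show 0 < α + 1 by linarith) k).ne'
  have hk := mul_poch_add_one (α + 1) k
  have ha1 : α + 1 ≠ 0 := by linarith
  have ha2 : α + 2 ≠ 0 := by linarith
  rw [show α + 1 + 1 = α + 2 by ring, mul_comm, ← eq_div_iff ha1] at hk
  have hs : ((-1 : ℝ) ^ k) * (-1) ^ k = 1 := by rw [← mul_pow]; simp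
  rw [laguerreCoeff_eq hα h, laguerreCoeff_eq hα n.zero_le, monomialImageCoeff, hk,
    Nat.cast_choose ℝ h, show k + r + 1 = k + (r + 1) by ring, pow_add _ k (r + 1)]
  have hp0 : poch (α + 1) 0 = 1 := by simp [poch]
  simp only [hp0, Nat.factorial_zero, Nat.sub_zero, pow_zero]
  generalize (-1 : ℝ) ^ k = s at hs ⊢
  push_cast
  field_simp
  rw [sq, hs]
  ring

lemma sum_laguerreCoeff_mul_monomialImageCoeff {α : ℝ} (hα : -1 < α) {n r : ℕ} (h : r ≤ n) :
    ∑ k ∈ range (n + 1), laguerreCoeff α n k * monomialImageCoeff α k r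
      = -(laguerreCoeff α n 0 * r * (α + 1 + n)
          * ((α + 2) * (n - r) + (α + 1 + r) * (α + 2 + n))
          / ((α + 1) * (α + 2) * ((α + 1 + r) * (α + 2 + r)))) * laguerreCoeff α n r := by
  have key : ∀ k ∈ range (n + 1), laguerreCoeff α n k * monomialImageCoeff α k r
      = (-1) ^ (r + 1) * laguerreCoeff α n 0 / ((α + 1) * (α + 2)) * (r / r.factorial)
        * ((α + 1 + r) * (n.choose k * gbinom (α + 2) ((k : ℤ) - r))
          + (α + 2) * (n.choose k * gbinom (α + 1) ((k : ℤ) - (r + 1 : ℕ)))) := by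
    intro k hk
    rw [mem_range] at hk
    rw [laguerreCoeff_mul_monomialImageCoeff hα (by omega)]
    have habs := intCast_mul_gbinom (α + 1) ((k : ℤ) - r)
    rw [show α + 1 + 1 = α + 2 by ring,
      show (k : ℤ) - r - 1 = k - (r + 1 : ℕ) by push_cast; ring] at habs
    push_cast at habs ⊢
    congr 1
    linear_combination (n.choose k : ℝ) * habs
  rw [sum_congr rfl key, ← mul_sum, sum_add_distrib, ← mul_sum, ← mul_sum,
    sum_choose_mul_gbinom_sub, sum_choose_mul_gbinom_sub, gbinom_add_two_sub hα h,
    gbinom_add_one_sub_succ hα h]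
  have hr0 : (0 : ℝ) ≤ r := r.cast_nonneg
  have ha1 : α + 1 ≠ 0 := by linarith
  have ha2 : α + 2 ≠ 0 := by linarith
  have hb1 : α + 1 + r ≠ 0 := by linarith
  have hb2 : α + 2 + r ≠ 0 := by linarith
  have hs : ((-1 : ℝ) ^ r) * (-1) ^ r = 1 := by rw [← mul_pow]; simp
  rw [pow_succ]
  generalize (-1 : ℝ) ^ r = s at hs ⊢
  field_simp
  rw [sq, hs]
  ring

lemma sub_mul_choose_succ (n k : ℕ) :
    ((n : ℝ) + 1 - k) * ((n + 1).choose k : ℝ) = (n + 1) * (n.choose k : ℝ) := by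
  rcases le_or_gt k (n + 1) with h | h
  · have := congrArg (Nat.cast (R := ℝ)) (Nat.choose_mul_succ_eq n k)
    push_cast [Nat.cast_sub h] at this
    linarith
  · simp [Nat.choose_eq_zero_of_lt h, Nat.choose_eq_zero_of_lt (show n < k by omega)]

lemma sum_deriv_laguerreCoeff_mul_monomialImageCoeff {α : ℝ} (hα : -1 < α) {n r : ℕ}
    (h : r ≤ n) :
    ∑ k ∈ range (n + 1), ((k + 1) * laguerreCoeff α n (k + 1)) * monomialImageCoeff α k r
      = laguerreCoeff α n 0 * n * r * (n - r) * (α + 1 + n)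
          / ((α + 1) * (α + 2) * ((α + 1 + r) * (α + 2 + r))) * laguerreCoeff α n r := by
  have key : ∀ k ∈ range (n + 1),
      ((k + 1) * laguerreCoeff α n (k + 1)) * monomialImageCoeff α k r
      = (-1) ^ r * laguerreCoeff α n 0 / ((α + 1) * (α + 2)) * (r / r.factorial)
        * ((n - k) * n.choose k * gbinom (α + 2) ((k : ℤ) - r)) := by
    intro k hk
    rw [mem_range] at hk
    have hk0 : (0 : ℝ) ≤ k := k.cast_nonneg
    have hb : α + 1 + k ≠ 0 := by linarith
    have hm := laguerreCoeff_mul_monomialImageCoeff hα (show k ≤ n by omega) r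
    rw [pow_succ] at hm
    rw [laguerreCoeff_succ hα]
    trans -((n - k) / (α + 1 + k)) * (laguerreCoeff α n k * monomialImageCoeff α k r)
    · field_simp
    · rw [hm]
      field_simp
  rw [sum_congr rfl key, ← mul_sum]
  obtain _ | n := n
  · simp
  have hsum : ∑ k ∈ range (n + 1 + 1),
      ((n + 1 : ℕ) - k : ℝ) * (n + 1).choose k * gbinom (α + 2) ((k : ℤ) - r)
      = (n + 1) * gbinom ((n + 1 : ℕ) + (α + 1)) ((n + 1 : ℕ) - (r + 1 : ℕ)) := by
    have hv := sum_choose_mul_gbinom_sub n r (α + 2)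
    rw [show ((n + 1 : ℕ) : ℤ) - (r + 1 : ℕ) = n - r by push_cast; ring,
      show ((n + 1 : ℕ) : ℝ) + (α + 1) = n + (α + 2) by push_cast; ring, ← hv,
      sum_range_succ, mul_sum]
    push_cast
    simp only [sub_mul_choose_succ, mul_assoc]
    simp
  rw [hsum, gbinom_add_one_sub_succ hα h]
  have hr0 : (0 : ℝ) ≤ r := r.cast_nonneg
  have ha1 : α + 1 ≠ 0 := by linarith
  have ha2 : α + 2 ≠ 0 := by linarith
  have hb1 : α + 1 + r ≠ 0 := by linarith
  have hb2 : α + 2 + r ≠ 0 := by linarith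
  have hs : ((-1 : ℝ) ^ r) * (-1) ^ r = 1 := by rw [← mul_pow]; simp
  generalize (-1 : ℝ) ^ r = s at hs ⊢
  push_cast
  field_simp
  rw [sq, hs]
  ring

/-- Coefficient of `x ^ k` in `koornLaguerre α M n x`. -/
noncomputable def koornLaguerreCoeff (α M : ℝ) (n k : ℕ) : ℝ :=
  (1 + M * gbinom (n + α) ((n : ℤ) - 1)) * laguerreCoeff α n k
    + M * gbinom (n + α) n * ((k + 1) * laguerreCoeff α n (k + 1))

lemma koornLaguerreCoeff_of_lt (α M : ℝ) {n k : ℕ} (h : n < k) :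
    koornLaguerreCoeff α M n k = 0 := by
  simp [koornLaguerreCoeff, laguerreCoeff_of_lt α h, laguerreCoeff_of_lt α (Nat.lt_succ_of_lt h)]

lemma koornLaguerre_eq_sum_coeff (α M : ℝ) (n : ℕ) :
    koornLaguerre α M n = fun t => ∑ k ∈ range (n + 1), koornLaguerreCoeff α M n k * t ^ k := by
  funext t
  rw [koornLaguerre, laguerre_eq_sum_coeff,
    deriv_sum_monomials _ (laguerreCoeff_of_lt α n.lt_succ_self), mul_sum, mul_sum,
    ← sum_add_distrib]
  refine sum_congr rfl fun k _ => ?_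
  rw [koornLaguerreCoeff]
  ring

lemma gbinom_add_self (α : ℝ) (n : ℕ) : gbinom (n + α) n = laguerreCoeff α n 0 := by
  simp [laguerreCoeff]

lemma gbinom_add_sub_one {α : ℝ} (hα : -1 < α) (n : ℕ) :
    gbinom (n + α) ((n : ℤ) - 1) = n / (α + 1) * laguerreCoeff α n 0 := by
  have h := laguerreCoeff_succ hα n 0
  simp [laguerreCoeff] at h ⊢
  exact h

lemma gbinom_add_one_sub_one {α : ℝ} (hα : -1 < α) (n : ℕ) :
    gbinom (n + α + 1) ((n : ℤ) - 1)
      = n * (α + 1 + n) / ((α + 1) * (α + 2)) * laguerreCoeff α n 0 := by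
  have h := gbinom_add_one_sub_succ hα n.zero_le
  simpa [add_assoc] using h

/-- The differential equation of `L_n^{α,M}`, read off at the coefficient of `x ^ r`. -/
lemma koornLaguerreCoeff_equation {α : ℝ} (hα : -1 < α) (M : ℝ) {n r : ℕ} (h : r ≤ n) :
    M * (gbinom (n + α + 1) ((n : ℤ) - 1) * koornLaguerreCoeff α M n r
        + ∑ k ∈ range (n + 1), koornLaguerreCoeff α M n k * monomialImageCoeff α k r)
      + (r + (α + 1)) * ((r + 1) * koornLaguerreCoeff α M n (r + 1))
      + (n - r) * koornLaguerreCoeff α M n r = 0 := by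
  have hsum : ∑ k ∈ range (n + 1), koornLaguerreCoeff α M n k * monomialImageCoeff α k r
      = (1 + M * gbinom (n + α) ((n : ℤ) - 1))
          * ∑ k ∈ range (n + 1), laguerreCoeff α n k * monomialImageCoeff α k r
        + M * gbinom (n + α) n * ∑ k ∈ range (n + 1),
          ((k + 1) * laguerreCoeff α n (k + 1)) * monomialImageCoeff α k r := by
    rw [mul_sum, mul_sum, ← sum_add_distrib]
    refine sum_congr rfl fun k _ => ?_
    rw [koornLaguerreCoeff]
    ring
  rw [hsum, sum_laguerreCoeff_mul_monomialImageCoeff hα h,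
    sum_deriv_laguerreCoeff_mul_monomialImageCoeff hα h, koornLaguerreCoeff, koornLaguerreCoeff,
    gbinom_add_one_sub_one hα, gbinom_add_sub_one hα, gbinom_add_self,
    laguerreCoeff_succ hα n (r + 1), laguerreCoeff_succ hα n r]
  have hr0 : (0 : ℝ) ≤ r := r.cast_nonneg
  have ha1 : α + 1 ≠ 0 := by linarith
  have ha2 : α + 2 ≠ 0 := by linarith
  have hb1 : α + 1 + r ≠ 0 := by linarith
  have hb2 : α + 2 + r ≠ 0 := by linarith
  have hb3 : α + 1 + (r + 1) ≠ 0 := by linarith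
  have hr1 : (r : ℝ) + 1 ≠ 0 := by linarith
  have hr2 : (r : ℝ) + 1 + 1 ≠ 0 := by linarith
  push_cast
  rw [show α + 1 + ((r : ℝ) + 1) = α + 2 + r by ring]
  field_simp
  ring

/-- The infinite order differential equation for the Koornwinder generalized
Laguerre polynomials `L_n^{α,M}`. -/
theorem statement0 (α : ℝ) (hα : -1 < α) (M : ℝ) (n : ℕ) (x : ℝ) :
    M * (gbinom ((n : ℝ) + α + 1) ((n : ℤ) - 1) * koornLaguerre α M n x
        + ∑' i : ℕ, aFun α (i + 1) x * iteratedDeriv (i + 1) (koornLaguerre α M n) x)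
      + x * iteratedDeriv 2 (koornLaguerre α M n) x
      + (α + 1 - x) * deriv (koornLaguerre α M n) x
      + (n : ℝ) * koornLaguerre α M n x = 0 := by
  have hc : koornLaguerreCoeff α M n (n + 1) = 0 := koornLaguerreCoeff_of_lt α M n.lt_succ_self
  have hc' : (((n + 1 : ℕ) : ℝ) + 1) * koornLaguerreCoeff α M n (n + 1 + 1) = 0 := by
    rw [koornLaguerreCoeff_of_lt α M (by omega), mul_zero]
  have h1 : deriv (koornLaguerre α M n)
      = fun t => ∑ k ∈ range (n + 1), ((k : ℝ) + 1) * koornLaguerreCoeff α M n (k + 1) * t ^ k := by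
    rw [koornLaguerre_eq_sum_coeff]
    exact funext fun t => deriv_sum_monomials _ hc t
  rw [iteratedDeriv_succ, iteratedDeriv_one, h1,
    deriv_sum_monomials (fun k : ℕ => ((k : ℝ) + 1) * koornLaguerreCoeff α M n (k + 1)) hc',
    koornLaguerre_eq_sum_coeff, tsum_aFun_mul_iteratedDeriv hα]
  set y := koornLaguerreCoeff α M n
  have hx2 : x * ∑ k ∈ range (n + 1),
        ((k : ℝ) + 1) * (((k + 1 : ℕ) + 1) * y (k + 1 + 1)) * x ^ k
      = ∑ r ∈ range (n + 1), r * ((r + 1) * y (r + 1)) * x ^ r := by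
    rw [sum_range_succ, sum_range_succ', show y (n + 1 + 1) = 0 from
      koornLaguerreCoeff_of_lt α M (by omega), mul_add, mul_sum]
    simp only [Nat.cast_zero, mul_zero, zero_mul, add_zero]
    refine sum_congr rfl fun k _ => ?_
    push_cast
    ring
  have hx1 : x * ∑ k ∈ range (n + 1), ((k : ℝ) + 1) * y (k + 1) * x ^ k
      = ∑ r ∈ range (n + 1), r * y r * x ^ r := by
    rw [sum_range_succ, sum_range_succ', hc, mul_add, mul_sum]
    simp only [Nat.cast_zero, mul_zero, zero_mul, add_zero]
    refine sum_congr rfl fun k _ => ?_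
    push_cast
    ring
  beta_reduce
  rw [sub_mul, hx2, hx1, mul_add]
  simp only [mul_sum]
  rw [← sum_add_distrib, ← sum_add_distrib, ← sum_sub_distrib, ← sum_add_distrib,
    ← sum_add_distrib]
  refine sum_eq_zero fun r hr => ?_
  rw [mem_range] at hr
  linear_combination x ^ r * koornLaguerreCoeff_equation hα M (show r ≤ n by omega)
end

section
/- If α is a nonnegative integer, then for every integer k ≥ 1 and every real x, Σ_{i=k}^∞ C(i,k)·a_i(α,x) = (−1)^{α+k}·a_k(α,−x) (the sum is finite since a_i(α,·) = 0 for i ≥ 2α+5). -/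
open Finset

open scoped Nat

theorem gbinom_natCast_s4 (n k : ℕ) : gbinom (n : ℝ) (k : ℤ) = (n.choose k : ℝ) := by
  have h : ∏ j ∈ Finset.range k, ((n : ℝ) - (j : ℝ)) = (n.descFactorial k : ℝ) := by
    induction k with
    | zero => simp
    | succ k ih =>
      rw [Finset.prod_range_succ, ih, Nat.descFactorial_succ, Nat.cast_mul, mul_comm]
      rcases le_or_gt k n with hkn | hkn
      · rw [Nat.cast_sub hkn]
      · simp [Nat.descFactorial_of_lt hkn]
  rw [gbinom, if_pos (Int.natCast_nonneg k), Int.toNat_natCast, h,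
    Nat.descFactorial_eq_factorial_mul_choose, Nat.cast_mul,
    mul_div_cancel_left₀ _ (Nat.cast_ne_zero.2 k.factorial_ne_zero)]

theorem poch_natCast_add_one (n k : ℕ) : poch ((n : ℝ) + 1) k = ((n + k)! : ℝ) / (n ! : ℝ) := by
  rw [eq_div_iff (Nat.cast_ne_zero.2 n.factorial_ne_zero), ← Nat.factorial_mul_ascFactorial n k,
    Nat.ascFactorial_eq_prod_range, poch]
  push_cast
  ring

/-- `∑ p ≤ n, (-1)^p C(n,p) C(y+p,r)` is, up to sign, the `n`-th forward difference of
`C(·,r)` at `y`. -/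
theorem sum_neg_one_pow_mul_choose_mul_choose_add (n y r : ℕ) :
    ∑ p ∈ Finset.range (n + 1), (-1 : ℝ) ^ p * (n.choose p : ℝ) * ((y + p).choose r : ℝ) =
      if n ≤ r then (-1 : ℝ) ^ n * (y.choose (r - n) : ℝ) else 0 := by
  have hdiff : (fwdDiff (1 : ℕ))^[n] (fun x ↦ x.choose r : ℕ → ℤ) y =
      if n ≤ r then (y.choose (r - n) : ℤ) else 0 := by
    split_ifs with h
    · obtain ⟨d, rfl⟩ := Nat.exists_eq_add_of_le h
      rw [fwdDiff_iter_choose, Nat.add_sub_cancel_left]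
    · obtain ⟨d, rfl⟩ := Nat.exists_eq_add_of_lt (not_le.1 h)
      have hr := fwdDiff_iter_choose 0 r
      rw [add_zero] at hr
      rw [show r + d + 1 = (d + 1) + r by ring, Function.iterate_add_apply, hr,
        Function.iterate_add_apply]
      simp only [Nat.choose_zero_right, Function.iterate_one, Nat.cast_one, fwdDiff_const]
      rw [fwdDiff_iter_eq_sum_shift]
      simp
  rw [fwdDiff_iter_eq_sum_shift] at hdiff
  have hreal := congrArg (fun z : ℤ ↦ (-1 : ℝ) ^ n * (z : ℝ)) hdiff
  simp only [Int.cast_sum, Finset.mul_sum] at hreal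
  convert hreal using 1
  · refine Finset.sum_congr rfl fun p hp ↦ ?_
    obtain ⟨d, rfl⟩ := Nat.exists_eq_add_of_le (Nat.lt_succ_iff.1 (Finset.mem_range.1 hp))
    have hsq : (-1 : ℝ) ^ d * (-1) ^ d = 1 := by rw [← mul_pow]; simp
    simp only [smul_eq_mul, Nat.add_sub_cancel_left, mul_one]
    push_cast
    rw [pow_add]
    linear_combination (-(-1 : ℝ) ^ p * ((p + d).choose p : ℝ) * ((y + p).choose r : ℝ)) * hsq
  · split_ifs <;> simp

/-- The coefficient of `x ^ j` in `a_{j+p}(α, x)`, for a natural number `α`. -/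
noncomputable def shiftedCoeff (α j p : ℕ) : ℝ :=
  -(-1) ^ p * ((α + 1).choose (j - 1) : ℝ) * ((α + 2).choose p : ℝ) *
    ((α + 2 + p)! : ℝ) / (((α + 2)! : ℝ) * ((j + p)! : ℝ))

/-- The coefficient of `x ^ j` in `a_i(α, x)`, for a natural number `α` and `1 ≤ j`. -/
noncomputable def aCoeff (α i j : ℕ) : ℝ :=
  if j ≤ i then shiftedCoeff α j (i - j) else 0

theorem aCoeff_of_lt {α i j : ℕ} (h : i < j) : aCoeff α i j = 0 := if_neg (not_le.2 h)

theorem aCoeff_add_left (α j p : ℕ) : aCoeff α (p + j) j = shiftedCoeff α j p := by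
  rw [aCoeff, if_pos (Nat.le_add_left j p), Nat.add_sub_cancel]

theorem aCoeff_eq_zero_of_lt {α i j : ℕ} (h : α + 2 < j) : aCoeff α i j = 0 := by
  rw [aCoeff, shiftedCoeff, Nat.choose_eq_zero_of_lt (show α + 1 < j - 1 by omega)]
  simp

theorem aFun_natCast (α i : ℕ) (x : ℝ) :
    aFun (α : ℝ) i x = ∑ j ∈ Finset.Icc 1 (α + 2), aCoeff α i j * x ^ j := by
  have hsum : aFun (α : ℝ) i x = ∑ j ∈ Finset.Icc 1 i, aCoeff α i j * x ^ j := by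
    rw [aFun, Finset.mul_sum]
    refine Finset.sum_congr rfl fun j hj ↦ ?_
    obtain ⟨hj1, hji⟩ := Finset.mem_Icc.1 hj
    obtain ⟨p, rfl⟩ := Nat.exists_eq_add_of_le' hji
    have hpred : ((j : ℤ) - 1) = ((j - 1 : ℕ) : ℤ) := by omega
    have hdiff : (((p + j : ℕ) : ℤ) - (j : ℤ)) = (p : ℤ) := by omega
    have h1 : ((α : ℝ) + 1) = ((α + 1 : ℕ) : ℝ) := by push_cast; ring
    have h2 : ((α : ℝ) + 2) = ((α + 2 : ℕ) : ℝ) := by push_cast; ring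
    have h3 : ((α : ℝ) + 3) = ((α + 2 : ℕ) : ℝ) + 1 := by push_cast; ring
    have hsign : (-1 : ℝ) ^ (p + j + j + 1) = -(-1) ^ p := by
      rw [pow_succ, add_assoc, pow_add, ← two_mul, pow_mul]; simp
    rw [aCoeff_add_left, shiftedCoeff, hpred, hdiff, h1, h2, h3, gbinom_natCast_s4, gbinom_natCast_s4,
      Nat.add_sub_cancel, poch_natCast_add_one, hsign, add_comm p j]
    field_simp
  rw [hsum]
  trans ∑ j ∈ Finset.Icc 1 (i + (α + 2)), aCoeff α i j * x ^ j
  · refine Finset.sum_subset (Finset.Icc_subset_Icc_right (by omega)) fun j hj hj' ↦ ?_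
    simp only [Finset.mem_Icc] at hj hj'
    rw [aCoeff_of_lt (by omega), zero_mul]
  · refine (Finset.sum_subset (Finset.Icc_subset_Icc_right (by omega)) fun j hj hj' ↦ ?_).symm
    simp only [Finset.mem_Icc] at hj hj'
    rw [aCoeff_eq_zero_of_lt (by omega), zero_mul]

theorem choose_mul_factorial_div_factorial {m j k p : ℕ} (hj : j ≤ m) :
    ((p + j).choose k : ℝ) * ((m + p)! : ℝ) / ((j + p)! : ℝ) =
      ((m + p).choose (m + k - j) : ℝ) * ((m + k - j)! : ℝ) / (k ! : ℝ) := by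
  rcases le_or_gt k (p + j) with h | h
  · rw [Nat.cast_choose ℝ h, Nat.cast_choose ℝ (show m + k - j ≤ m + p by omega),
      show m + p - (m + k - j) = p + j - k by omega, add_comm j p]
    have hne (n : ℕ) : (n ! : ℝ) ≠ 0 := Nat.cast_ne_zero.2 n.factorial_ne_zero
    have h1 := hne (p + j)
    have h2 := hne (p + j - k)
    have h3 := hne (m + k - j)
    field_simp
  · rw [Nat.choose_eq_zero_of_lt h, Nat.choose_eq_zero_of_lt (show m + p < m + k - j by omega)]
    simp

theorem sum_choose_mul_shiftedCoeff {α j k : ℕ} (hj : j ≤ α + 2) :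
    ∑ p ∈ Finset.range (α + 2 + 1), ((p + j).choose k : ℝ) * shiftedCoeff α j p =
      (-1) ^ (α + k) * (aCoeff α k j * (-1) ^ j) := by
  set c : ℝ := -((α + 1).choose (j - 1) : ℝ) * ((α + 2 + k - j)! : ℝ) /
    (((α + 2)! : ℝ) * (k ! : ℝ)) with hc
  have hterm (p : ℕ) : ((p + j).choose k : ℝ) * shiftedCoeff α j p =
      c * ((-1) ^ p * ((α + 2).choose p : ℝ) * ((α + 2 + p).choose (α + 2 + k - j) : ℝ)) := by
    trans (-(-1) ^ p * ((α + 1).choose (j - 1) : ℝ) * ((α + 2).choose p : ℝ) / ((α + 2)! : ℝ)) *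
      (((p + j).choose k : ℝ) * ((α + 2 + p)! : ℝ) / ((j + p)! : ℝ))
    · rw [shiftedCoeff]
      ring
    · rw [choose_mul_factorial_div_factorial hj, hc]
      ring
  simp only [hterm]
  rw [← Finset.mul_sum, sum_neg_one_pow_mul_choose_mul_choose_add]
  rcases le_or_gt j k with h | h
  · obtain ⟨s, rfl⟩ := Nat.exists_eq_add_of_le' h
    have hsign : (-1 : ℝ) ^ (α + (s + j)) * (-(-1) ^ s * (-1) ^ j) = -(-1) ^ (α + 2) := by
      have hs : (-1 : ℝ) ^ s * (-1) ^ s = 1 := by rw [← mul_pow]; simp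
      have hj2 : (-1 : ℝ) ^ j * (-1) ^ j = 1 := by rw [← mul_pow]; simp
      simp only [pow_add]
      linear_combination (-(-1 : ℝ) ^ α * (-1) ^ j * (-1) ^ j) * hs - (-1 : ℝ) ^ α * hj2
    rw [if_pos (by omega), aCoeff_add_left, shiftedCoeff, hc,
      show α + 2 + (s + j) - j - (α + 2) = s by omega, show α + 2 + (s + j) - j = α + 2 + s by omega,
      add_comm j s]
    linear_combination (-((α + 1).choose (j - 1) : ℝ) * ((α + 2).choose s : ℝ) *
      ((α + 2 + s)! : ℝ) / (((α + 2)! : ℝ) * ((s + j)! : ℝ))) * hsign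
  · rw [if_neg (by omega), aCoeff_of_lt h]
    simp

theorem hasSum_choose_mul_aCoeff {α j k : ℕ} (hj : j ≤ α + 2) :
    HasSum (fun i : ℕ ↦ ((i + k).choose k : ℝ) * aCoeff α (i + k) j)
      ((-1) ^ (α + k) * (aCoeff α k j * (-1) ^ j)) := by
  have hshift : HasSum (fun p : ℕ ↦ ((p + j).choose k : ℝ) * aCoeff α (p + j) j)
      ((-1) ^ (α + k) * (aCoeff α k j * (-1) ^ j)) := by
    simp only [aCoeff_add_left]
    rw [← sum_choose_mul_shiftedCoeff hj]
    refine hasSum_sum_of_ne_finset_zero fun p hp ↦ ?_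
    rw [shiftedCoeff, Nat.choose_eq_zero_of_lt (show α + 2 < p by simpa using hp)]
    simp
  have hall := (hasSum_nat_add_iff (f := fun i ↦ (i.choose k : ℝ) * aCoeff α i j) j).1 hshift
  rw [Finset.sum_eq_zero fun i hi ↦ by rw [aCoeff_of_lt (Finset.mem_range.1 hi), mul_zero],
    add_zero] at hall
  refine (hasSum_nat_add_iff (f := fun i ↦ (i.choose k : ℝ) * aCoeff α i j) k).2 ?_
  rwa [Finset.sum_eq_zero fun i hi ↦ by
    rw [Nat.choose_eq_zero_of_lt (Finset.mem_range.1 hi), Nat.cast_zero, zero_mul], add_zero]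

/-- For nonnegative integer `α`: `∑_{i=k}^∞ C(i,k) a_i(α,x) = (-1)^{α+k} a_k(α,-x)`. -/
theorem statement4 (α : ℕ) (k : ℕ) (hk : 1 ≤ k) (x : ℝ) :
    ∑' i : ℕ, (Nat.choose (i + k) k : ℝ) * aFun (α : ℝ) (i + k) x
      = (-1 : ℝ) ^ (α + k) * aFun (α : ℝ) k (-x) := by
  refine HasSum.tsum_eq ?_
  simp only [aFun_natCast, Finset.mul_sum]
  refine hasSum_sum fun j hj ↦ ?_
  have h := (hasSum_choose_mul_aCoeff (k := k) (Finset.mem_Icc.1 hj).2).mul_right (x ^ j)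
  rw [neg_pow x j]
  simpa only [mul_assoc] using h
end

section
/- For every real α > −1 and every integer j ≥ 1, the series Σ_{i=0}^∞ (−1)^i C(α+2, i) (α+3)_i/(i+j)! converges and equals Γ(j)/(Γ(j+α+3)·Γ(j−α−2)), where 1/Γ is interpreted as the entire function taking the value 0 at nonpositive integers. -/
open Finset

open Filter Topology

/-- The numerator `(-1)^i C(a,i) (a+1)_i` of the hypergeometric series. -/
noncomputable def hyperNum (a : ℝ) (i : ℕ) : ℝ :=
  (-1 : ℝ) ^ i * gbinom a (i : ℤ) * poch (a + 1) i

/-- The term of the hypergeometric series with denominator `(i+j)!`. -/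
noncomputable def hyperTerm (a : ℝ) (j i : ℕ) : ℝ :=
  hyperNum a i / (Nat.factorial (i + j) : ℝ)

/-- The closed form of the sum of the hypergeometric series. -/
noncomputable def gammaQuotient (a : ℝ) (j : ℕ) : ℝ :=
  Real.Gamma j / (Real.Gamma (j + a + 1) * Real.Gamma (j - a))

lemma hyperNum_zero (a : ℝ) : hyperNum a 0 = 1 := by
  simp [hyperNum, gbinom, poch]

lemma hyperNum_succ (a : ℝ) (i : ℕ) :
    hyperNum a (i + 1) = hyperNum a i * ((i - a) * (i + 1 + a)) / (i + 1) := by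
  have h1 : gbinom a ((i + 1 : ℕ) : ℤ) = gbinom a (i : ℤ) * (a - i) / (i + 1) := by
    simp only [gbinom, Int.natCast_nonneg, if_true, Int.toNat_natCast, prod_range_succ,
      Nat.factorial_succ]
    push_cast
    field_simp
  have h2 : poch (a + 1) (i + 1) = poch (a + 1) i * (a + 1 + i) := by
    simp only [poch, prod_range_succ]
  rw [hyperNum, h1, h2, hyperNum, pow_succ]
  ring

lemma abs_sub_mul_add_le {a x : ℝ} (ha : 0 ≤ a) (hx : a ≤ x) :
    |(x - a) * (x + 1 + a)| ≤ x * (x + 1) := by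
  rw [abs_of_nonneg (mul_nonneg (by linarith) (by linarith))]
  nlinarith [mul_nonneg ha ha]

lemma exists_abs_hyperNum_mul_le {a : ℝ} (ha : 0 ≤ a) :
    ∃ C : ℝ, 0 ≤ C ∧ ∀ᶠ i : ℕ in atTop, |hyperNum a i| * i ≤ C * (Nat.factorial i : ℝ) := by
  obtain ⟨N, hN⟩ := exists_nat_ge a
  refine ⟨|hyperNum a N| * N, by positivity, ?_⟩
  filter_upwards [eventually_ge_atTop N] with i hi
  induction i, hi using Nat.le_induction with
  | base =>
    exact le_mul_of_one_le_right (by positivity) (by exact_mod_cast Nat.factorial_pos N)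
  | succ i hi ih =>
    have hai : a ≤ i := hN.trans (by exact_mod_cast hi)
    have h := abs_sub_mul_add_le ha hai
    have hi1 : (0 : ℝ) < i + 1 := by positivity
    rw [hyperNum_succ, abs_div, abs_mul, abs_of_pos hi1, Nat.factorial_succ]
    push_cast
    rw [div_mul_cancel₀ _ hi1.ne']
    calc |hyperNum a i| * |(i - a) * (i + 1 + a)|
        ≤ |hyperNum a i| * (i * (i + 1)) := by gcongr
      _ = (|hyperNum a i| * i) * (i + 1) := by ring
      _ ≤ (|hyperNum a N| * N * (Nat.factorial i : ℝ)) * (i + 1) := by gcongr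
      _ = _ := by ring

lemma exists_abs_hyperTerm_mul_le {a : ℝ} (ha : 0 ≤ a) {j : ℕ} (hj : 1 ≤ j) :
    ∃ C : ℝ, 0 ≤ C ∧ ∀ᶠ i : ℕ in atTop, |hyperTerm a j i| * i ≤ C / (i + 1) := by
  obtain ⟨C, hC, h⟩ := exists_abs_hyperNum_mul_le ha
  refine ⟨C, hC, ?_⟩
  filter_upwards [h] with i hi
  have hf : ((i : ℝ) + 1) * (Nat.factorial i : ℝ) ≤ (Nat.factorial (i + j) : ℝ) := by
    exact_mod_cast (Nat.factorial_succ i) ▸ Nat.factorial_le (by omega : i + 1 ≤ i + j)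
  have hp : (0 : ℝ) < (Nat.factorial (i + j) : ℝ) := by positivity
  rw [hyperTerm, abs_div, abs_of_pos hp, div_mul_eq_mul_div, div_le_div_iff₀ hp (by positivity)]
  calc |hyperNum a i| * i * (i + 1) ≤ C * (Nat.factorial i : ℝ) * (i + 1) := by gcongr
    _ = C * ((i + 1) * (Nat.factorial i : ℝ)) := by ring
    _ ≤ _ := by gcongr

lemma summable_hyperTerm {a : ℝ} (ha : 0 ≤ a) {j : ℕ} (hj : 1 ≤ j) :
    Summable (hyperTerm a j) := by
  obtain ⟨C, hC, h⟩ := exists_abs_hyperTerm_mul_le ha hj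
  refine Summable.of_norm_bounded_eventually_nat
    (((Real.summable_nat_pow_inv (p := 2)).2 (by norm_num)).mul_left C) ?_
  filter_upwards [h, eventually_gt_atTop 0] with i hi hi0
  have hi0' : (0 : ℝ) < i := by exact_mod_cast hi0
  rw [Real.norm_eq_abs, ← div_eq_mul_inv, le_div_iff₀ (by positivity)]
  calc |hyperTerm a j i| * (i : ℝ) ^ 2 = |hyperTerm a j i| * i * i := by ring
    _ ≤ C / (i + 1) * i := by gcongr
    _ ≤ C := by
      rw [div_mul_eq_mul_div, div_le_iff₀ (by positivity)]
      nlinarith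

lemma tendsto_mul_hyperTerm {a : ℝ} (ha : 0 ≤ a) {j : ℕ} (hj : 1 ≤ j) :
    Tendsto (fun i : ℕ => -((i : ℝ) * hyperTerm a j i)) atTop (𝓝 0) := by
  obtain ⟨C, -, h⟩ := exists_abs_hyperTerm_mul_le ha hj
  have hlim : Tendsto (fun i : ℕ => C / ((i : ℝ) + 1)) atTop (𝓝 0) :=
    tendsto_const_nhds.div_atTop (tendsto_natCast_atTop_atTop.atTop_add tendsto_const_nhds)
  refine squeeze_zero_norm' ?_ hlim
  filter_upwards [h] with i hi
  rwa [norm_neg, norm_mul, Real.norm_natCast, Real.norm_eq_abs, mul_comm]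

lemma hyperTerm_telescope (a : ℝ) (j i : ℕ) :
    j * hyperTerm a j i - (j + 1 + a) * (j - a) * hyperTerm a (j + 1) i =
      -(((i + 1 : ℕ) : ℝ) * hyperTerm a j (i + 1)) - -((i : ℝ) * hyperTerm a j i) := by
  have h1 : i + (j + 1) = (i + j) + 1 := by ring
  have h2 : i + 1 + j = (i + j) + 1 := by ring
  simp only [hyperTerm, hyperNum_succ, h1, h2, Nat.factorial_succ]
  have : (Nat.factorial (i + j) : ℝ) ≠ 0 := by positivity
  push_cast
  field_simp
  ring

lemma tsum_hyperTerm_recurrence {a : ℝ} (ha : 0 ≤ a) {j : ℕ} (hj : 1 ≤ j) :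
    j * ∑' i, hyperTerm a j i = (j + 1 + a) * (j - a) * ∑' i, hyperTerm a (j + 1) i := by
  have h1 := ((summable_hyperTerm ha hj).hasSum.mul_left (j : ℝ)).sub
    ((summable_hyperTerm ha (j := j + 1) (by omega)).hasSum.mul_left ((j + 1 + a) * (j - a)))
  have h2 := h1.tendsto_sum_nat
  simp only [hyperTerm_telescope] at h2
  simp only [sum_range_sub (fun i : ℕ => -((i : ℝ) * hyperTerm a j i))] at h2
  have h3 := (tendsto_mul_hyperTerm ha hj).sub_const (-(((0 : ℕ) : ℝ) * hyperTerm a j 0))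
  have h4 := tendsto_nhds_unique h2 h3
  simp only [Nat.cast_zero, zero_mul, neg_zero, sub_zero] at h4
  linarith

lemma inv_Gamma_eq (s : ℝ) : (Real.Gamma s)⁻¹ = s * (Real.Gamma (s + 1))⁻¹ := by
  rcases eq_or_ne s 0 with rfl | hs
  · simp [Real.Gamma_zero]
  · rw [Real.Gamma_add_one hs, mul_inv, mul_inv_cancel_left₀ hs]

lemma gammaQuotient_recurrence (a : ℝ) {j : ℕ} (hj : 1 ≤ j) :
    j * gammaQuotient a j = (j + 1 + a) * (j - a) * gammaQuotient a (j + 1) := by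
  have hj0 : (j : ℝ) ≠ 0 := by positivity
  have h1 := inv_Gamma_eq (j + a + 1)
  have h2 := inv_Gamma_eq (j - a)
  simp only [gammaQuotient, div_eq_mul_inv, mul_inv, h1, h2]
  push_cast
  rw [Real.Gamma_add_one hj0, show (j : ℝ) + 1 + a + 1 = j + a + 1 + 1 by ring,
    show (j : ℝ) + 1 - a = j - a + 1 by ring]
  ring

lemma prod_add_mul_Gamma {s : ℝ} (hs : 0 < s) (n : ℕ) :
    (∏ k ∈ range n, (s + k)) * Real.Gamma s = Real.Gamma (s + n) := by
  induction n with
  | zero => simp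
  | succ n ih =>
    rw [prod_range_succ, mul_right_comm, ih]
    push_cast
    rw [← add_assoc, Real.Gamma_add_one (by positivity), mul_comm]

lemma tendsto_rpow_mul_factorial_div_Gamma (s : ℝ) :
    Tendsto (fun n : ℕ => (n : ℝ) ^ s * (Nat.factorial n : ℝ) * (Real.Gamma (s + n + 1))⁻¹)
      atTop (𝓝 1) := by
  obtain ⟨N, hN⟩ := exists_nat_gt (-s)
  induction N generalizing s with
  | zero =>
    have hs : 0 < s := by simpa using hN
    have hG := (Real.Gamma_pos_of_pos hs).ne'
    have h := (Real.GammaSeq_tendsto_Gamma s).div_const (Real.Gamma s)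
    rw [div_self hG] at h
    refine h.congr fun n => ?_
    have hp := prod_add_mul_Gamma hs (n + 1)
    push_cast at hp
    rw [Real.GammaSeq, add_assoc s, ← hp, div_div, div_eq_mul_inv]
  | succ N ih =>
    push_cast at hN
    have h := ih (s + 1) (by linarith)
    have h' : Tendsto (fun n : ℕ => (s + 1) / (n : ℝ) + 1) atTop (𝓝 1) := by
      simpa using (tendsto_const_div_atTop_nhds_zero_nat (s + 1)).add_const 1
    have h2 := h'.mul h
    rw [one_mul] at h2
    refine h2.congr' ?_
    filter_upwards [eventually_gt_atTop 0] with n hn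
    have hn' : (0 : ℝ) < n := by exact_mod_cast hn
    rw [inv_Gamma_eq (s + n + 1), Real.rpow_add_one hn'.ne',
      show s + 1 + (n : ℝ) + 1 = s + n + 1 + 1 by ring]
    field_simp
    ring

lemma tendsto_factorial_mul_gammaQuotient (a : ℝ) :
    Tendsto (fun j : ℕ => (Nat.factorial j : ℝ) * gammaQuotient a j) atTop (𝓝 1) := by
  have h := (tendsto_rpow_mul_factorial_div_Gamma a).mul
    (tendsto_rpow_mul_factorial_div_Gamma (-a - 1))
  rw [one_mul] at h
  refine h.congr' ?_
  filter_upwards [eventually_gt_atTop 0] with j hj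
  have hj' : (0 : ℝ) < j := by exact_mod_cast hj
  have hf : (Nat.factorial j : ℝ) = j * Real.Gamma j := by
    rw [← Real.Gamma_nat_eq_factorial, Real.Gamma_add_one hj'.ne']
  have hpow : (j : ℝ) ^ a * (j : ℝ) ^ (-a - 1) * j = 1 := by
    rw [← Real.rpow_add hj', ← Real.rpow_add_one hj'.ne']
    rw [show a + (-a - 1) + 1 = 0 by ring, Real.rpow_zero]
  rw [gammaQuotient, show a + (j : ℝ) + 1 = j + a + 1 by ring,
    show -a - 1 + (j : ℝ) + 1 = j - a by ring, div_eq_mul_inv, mul_inv]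
  generalize (Real.Gamma (j + a + 1))⁻¹ = x
  generalize (Real.Gamma (j - a))⁻¹ = y
  rw [hf]
  linear_combination (j * Real.Gamma j ^ 2 * x * y) * hpow

lemma factorial_mul_abs_hyperTerm_le (a : ℝ) {j : ℕ} (hj : 1 ≤ j) (i : ℕ) :
    ‖(Nat.factorial j : ℝ) * hyperTerm a j i‖ ≤ |hyperTerm a 1 i| := by
  have hfac : Nat.factorial j * Nat.factorial (i + 1) ≤ Nat.factorial (i + j) := by
    induction j, hj using Nat.le_induction with
    | base => simp
    | succ j hj ih =>
      rw [← add_assoc, Nat.factorial_succ j, Nat.factorial_succ (i + j), mul_assoc]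
      exact Nat.mul_le_mul (by omega) ih
  have hfac' : (Nat.factorial j : ℝ) * (Nat.factorial (i + 1) : ℝ) ≤ Nat.factorial (i + j) := by
    exact_mod_cast hfac
  rw [Real.norm_eq_abs, hyperTerm, hyperTerm, abs_mul, abs_div, abs_div, Nat.abs_cast,
    Nat.abs_cast, Nat.abs_cast, ← mul_div_assoc, div_le_div_iff₀ (by positivity) (by positivity)]
  calc _ = |hyperNum a i| * ((Nat.factorial j : ℝ) * (Nat.factorial (i + 1) : ℝ)) := by ring
    _ ≤ _ := by gcongr

lemma tendsto_factorial_mul_hyperTerm (a : ℝ) (i : ℕ) :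
    Tendsto (fun j : ℕ => (Nat.factorial j : ℝ) * hyperTerm a j i) atTop
      (𝓝 (if i = 0 then 1 else 0)) := by
  rcases eq_or_ne i 0 with rfl | hi
  · refine tendsto_const_nhds.congr fun j => ?_
    have : (Nat.factorial j : ℝ) ≠ 0 := by positivity
    simp [hyperTerm, hyperNum_zero, this]
  · rw [if_neg hi]
    have hlim : Tendsto (fun j : ℕ => |hyperNum a i| / ((j : ℝ) + 1)) atTop (𝓝 0) :=
      tendsto_const_nhds.div_atTop (tendsto_natCast_atTop_atTop.atTop_add tendsto_const_nhds)
    refine squeeze_zero_norm (fun j => ?_) hlim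
    have hf : (Nat.factorial j : ℝ) * (j + 1) ≤ (Nat.factorial (i + j) : ℝ) := by
      rw [mul_comm]
      exact_mod_cast (Nat.factorial_succ j) ▸ Nat.factorial_le (by omega : j + 1 ≤ i + j)
    rw [Real.norm_eq_abs, hyperTerm, abs_mul, abs_div, Nat.abs_cast, Nat.abs_cast,
      ← mul_div_assoc, div_le_div_iff₀ (by positivity) (by positivity)]
    calc _ = |hyperNum a i| * ((Nat.factorial j : ℝ) * (j + 1)) := by ring
      _ ≤ _ := by gcongr

lemma tendsto_factorial_mul_tsum_hyperTerm {a : ℝ} (ha : 0 ≤ a) :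
    Tendsto (fun j : ℕ => (Nat.factorial j : ℝ) * ∑' i, hyperTerm a j i) atTop (𝓝 1) := by
  have h := tendsto_tsum_of_dominated_convergence
    (f := fun j i : ℕ => (Nat.factorial j : ℝ) * hyperTerm a j i)
    (summable_hyperTerm ha le_rfl).abs (tendsto_factorial_mul_hyperTerm a)
    ((eventually_ge_atTop 1).mono fun j hj => factorial_mul_abs_hyperTerm_le a hj)
  simpa only [tsum_ite_eq, tsum_mul_left] using h

/-- A solution of the contiguity recurrence that is `o(1/j!)` vanishes. -/
lemma eq_zero_of_recurrence {a : ℝ} (ha : 0 ≤ a) {D : ℕ → ℝ}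
    (hrec : ∀ j : ℕ, 1 ≤ j → j * D j = (j + 1 + a) * (j - a) * D (j + 1))
    (hlim : Tendsto (fun j : ℕ => (Nat.factorial j : ℝ) * D j) atTop (𝓝 0))
    {j : ℕ} (hj : 1 ≤ j) : D j = 0 := by
  obtain ⟨N, hN⟩ := exists_nat_ge a
  have hstep : ∀ m : ℕ, 1 ≤ m → N ≤ m →
      |(Nat.factorial m : ℝ) * D m| ≤ |(Nat.factorial (m + 1) : ℝ) * D (m + 1)| := by
    intro m hm hNm
    have hm0 : (0 : ℝ) < m := by exact_mod_cast hm
    have h := abs_sub_mul_add_le ha (hN.trans (by exact_mod_cast hNm : (N : ℝ) ≤ m))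
    have hD : m * |D m| = |(m - a) * (m + 1 + a)| * |D (m + 1)| := by
      rw [← abs_mul, ← Nat.abs_cast m, ← abs_mul, Nat.abs_cast, hrec m hm]
      ring_nf
    have hle : |D m| ≤ (m + 1) * |D (m + 1)| := by
      refine le_of_mul_le_mul_left ?_ hm0
      rw [hD, ← mul_assoc]
      gcongr
    rw [abs_mul, abs_mul, Nat.abs_cast, Nat.abs_cast, Nat.factorial_succ]
    push_cast
    calc (Nat.factorial m : ℝ) * |D m|
        ≤ (Nat.factorial m : ℝ) * ((m + 1) * |D (m + 1)|) := by gcongr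
      _ = _ := by ring
  have hlarge : ∀ m : ℕ, 1 ≤ m → N ≤ m → D m = 0 := by
    intro m hm hNm
    have hbound : ∀ n : ℕ, m ≤ n →
        |(Nat.factorial m : ℝ) * D m| ≤ |(Nat.factorial n : ℝ) * D n| := by
      intro n hn
      induction n, hn using Nat.le_induction with
      | base => exact le_rfl
      | succ n hn ih => exact ih.trans (hstep n (hm.trans hn) (hNm.trans hn))
    have habs := hlim.abs
    rw [abs_zero] at habs
    have h0 := ge_of_tendsto habs ((eventually_ge_atTop m).mono hbound)
    have h1 := abs_eq_zero.1 (le_antisymm h0 (abs_nonneg _))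
    exact (mul_eq_zero.1 h1).resolve_left (by positivity)
  have hdown : ∀ n m : ℕ, 1 ≤ m → D (m + n) = 0 → D m = 0 := by
    intro n
    induction n with
    | zero => exact fun m _ h => h
    | succ n ih =>
      intro m hm h
      have h1 : D (m + 1) = 0 := ih (m + 1) (by omega) (by rwa [add_assoc, add_comm 1 n])
      have h2 := hrec m hm
      rw [h1, mul_zero] at h2
      exact (mul_eq_zero.1 h2).resolve_left (by positivity)
  exact hdown N j hj (hlarge _ (by omega) (by omega))

lemma hasSum_hyperTerm {a : ℝ} (ha : 0 ≤ a) {j : ℕ} (hj : 1 ≤ j) :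
    HasSum (hyperTerm a j) (gammaQuotient a j) := by
  have hD := eq_zero_of_recurrence ha
    (D := fun j => ∑' i, hyperTerm a j i - gammaQuotient a j)
    (fun j hj => by
      rw [mul_sub, mul_sub, tsum_hyperTerm_recurrence ha hj, gammaQuotient_recurrence a hj])
    (by
      have h := (tendsto_factorial_mul_tsum_hyperTerm ha).sub
        (tendsto_factorial_mul_gammaQuotient a)
      simpa only [mul_sub, sub_self] using h) hj
  exact (sub_eq_zero.1 hD) ▸ (summable_hyperTerm ha hj).hasSum

/-- `∑_{i=0}^∞ (-1)^i C(α+2,i) (α+3)_i / (i+j)! = Γ(j) / (Γ(j+α+3) Γ(j-α-2))`,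
where `1/Γ` vanishes at nonpositive integers (Mathlib's `Real.Gamma` is `0` there,
so division by zero yields the right value). -/
theorem statement7 (α : ℝ) (hα : -1 < α) (j : ℕ) (hj : 1 ≤ j) :
    HasSum
      (fun i : ℕ => (-1 : ℝ) ^ i * gbinom (α + 2) (i : ℤ) * poch (α + 3) i /
        (Nat.factorial (i + j) : ℝ))
      (Real.Gamma (j : ℝ) / (Real.Gamma ((j : ℝ) + α + 3) * Real.Gamma ((j : ℝ) - α - 2))) := by
  have h := hasSum_hyperTerm (a := α + 2) (by linarith) hj
  rw [gammaQuotient, show (j : ℝ) + (α + 2) + 1 = j + α + 3 by ring,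
    show (j : ℝ) - (α + 2) = j - α - 2 by ring] at h
  unfold hyperTerm hyperNum at h
  rwa [show α + 2 + 1 = α + 3 by ring] at h
end

section
/- For every real α > −1, every integer n ≥ 1, every k ∈ {0,1,2} and every real x, Σ_{i=0}^∞ b_i^*(α,x)·(d/dx)^{i+k} L_n^α(x) equals 0 if k = 0, equals −1 if k = 1, and equals n−1 if k = 2 (i.e., it equals (−n)_k/(n·Γ(k)) with 1/Γ(0) = 0); the sum has only finitely many nonzero terms since L_n^α is a polynomial of degree n. -/
open Finset

/-- The coefficient functions `b_i^*(α, x) = (1/i!) ∑_{j=0}^i (-1)^j C(i,j) (α+1)_{i-j} x^j`. -/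
noncomputable def bStar (α : ℝ) (i : ℕ) (x : ℝ) : ℝ :=
  (1 / (Nat.factorial i : ℝ)) * ∑ j ∈ Finset.range (i + 1),
    (-1 : ℝ) ^ j * (Nat.choose i j : ℝ) * poch (α + 1) (i - j) * x ^ j

/-- The coefficient functions `c_i^*(x) = (-1)^i x^i / i!`. -/
noncomputable def cStar (i : ℕ) (x : ℝ) : ℝ :=
  (-1 : ℝ) ^ i * x ^ i / (Nat.factorial i : ℝ)

open Polynomial in
lemma iteratedDeriv_polynomial_eval (P : ℝ[X]) (i : ℕ) :
    iteratedDeriv i (fun x => P.eval x) = fun x => (derivative^[i] P).eval x := by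
  induction i with
  | zero => simp
  | succ i ih =>
    rw [iteratedDeriv_succ, ih, Function.iterate_succ_apply']
    ext x
    exact Polynomial.deriv _

open Polynomial in
/-- Taylor expansion of a polynomial about `x`, evaluated at the origin. -/
lemma sum_neg_pow_mul_iterate_derivative_eval (Q : ℝ[X]) {N : ℕ} (hN : Q.natDegree < N) (x : ℝ) :
    ∑ j ∈ range N, (-x) ^ j / (j.factorial : ℝ) * (derivative^[j] Q).eval x = Q.eval 0 := by
  have h : (taylor x Q).eval (-x) = Q.eval 0 := by rw [taylor_eval, neg_add_cancel]
  rw [← h, eval_eq_sum_range' (n := N) (by rwa [natDegree_taylor])]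
  refine sum_congr rfl fun j _ => ?_
  have hj : (j.factorial : ℝ) ≠ 0 := by positivity
  rw [taylor_coeff, ← factorial_smul_hasseDeriv, LinearMap.smul_apply, eval_smul, nsmul_eq_mul]
  field_simp

lemma bStar_eq_sum (α : ℝ) (i : ℕ) (x : ℝ) :
    bStar α i x = ∑ m ∈ range (i + 1),
      poch (α + 1) m / (m.factorial : ℝ) * ((-x) ^ (i - m) / ((i - m).factorial : ℝ)) := by
  rw [bStar, mul_sum, ← sum_flip]
  refine sum_congr rfl fun m hm => ?_
  have hm' : m ≤ i := Nat.lt_succ_iff.mp (mem_range.mp hm)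
  rw [Nat.choose_symm hm', Nat.sub_sub_self hm', Nat.cast_choose ℝ hm', neg_pow x]
  have h1 : (i.factorial : ℝ) ≠ 0 := by positivity
  field_simp

open Polynomial in
lemma tsum_bStar_mul_iterate_derivative_eval (α x : ℝ) (Q : ℝ[X]) {N : ℕ}
    (hN : Q.natDegree < N) :
    ∑' i : ℕ, bStar α i x * (derivative^[i] Q).eval x
      = ∑ m ∈ range N, poch (α + 1) m / (m.factorial : ℝ) * (derivative^[m] Q).eval 0 := by
  rw [tsum_eq_sum (s := range N)]
  · have h : ∀ i, bStar α i x * (derivative^[i] Q).eval x = ∑ m ∈ range (i + 1),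
        poch (α + 1) m / (m.factorial : ℝ) * ((-x) ^ (i - m) / ((i - m).factorial : ℝ) *
          (derivative^[i - m] (derivative^[m] Q)).eval x) := by
      intro i
      rw [bStar_eq_sum, sum_mul]
      refine sum_congr rfl fun m hm => ?_
      have hm' : m ≤ i := Nat.lt_succ_iff.mp (mem_range.mp hm)
      rw [← Function.iterate_add_apply, Nat.sub_add_cancel hm', mul_assoc]
    simp only [h]
    rw [sum_range_diag_flip N fun m j => poch (α + 1) m / (m.factorial : ℝ) *
      ((-x) ^ j / (j.factorial : ℝ) * (derivative^[j] (derivative^[m] Q)).eval x)]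
    refine sum_congr rfl fun m hm => ?_
    rw [← mul_sum, sum_neg_pow_mul_iterate_derivative_eval]
    have := natDegree_iterate_derivative Q m
    have := mem_range.mp hm
    omega
  · intro i hi
    rw [iterate_derivative_eq_zero (by rw [mem_range] at hi; omega), eval_zero, mul_zero]

lemma gbinom_natCast_s10 (z : ℝ) (k : ℕ) : gbinom z k = Ring.choose z k := by
  rw [Ring.choose_eq_smul, ← Polynomial.aeval_eq_smeval, Polynomial.aeval_def,
    Polynomial.eval₂_eq_eval_map, descPochhammer_map, descPochhammer_eval_eq_prod_range]
  simp [gbinom, div_eq_inv_mul]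

lemma poch_div_factorial (a : ℝ) (m : ℕ) :
    poch a m / (m.factorial : ℝ) = (-1) ^ m * Ring.choose (-a) m := by
  rw [← gbinom_natCast_s10, gbinom, if_pos (Int.natCast_nonneg m), Int.toNat_natCast, mul_div_assoc',
    poch]
  congr 1
  rw [← card_range m, ← prod_const, card_range, ← prod_mul_distrib]
  exact prod_congr rfl fun j _ => by ring

open Polynomial in
/-- The Laguerre polynomial `L_n^α` as an element of `ℝ[X]`. -/
noncomputable def laguerrePoly (α : ℝ) (n : ℕ) : ℝ[X] :=
  ∑ k ∈ range (n + 1),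
    monomial k ((-1) ^ k * Ring.choose ((n : ℝ) + α) (n - k) / (k.factorial : ℝ))

open Polynomial in
lemma laguerre_eq_eval (α : ℝ) (n : ℕ) : laguerre α n = fun x => (laguerrePoly α n).eval x := by
  ext x
  rw [laguerre, laguerrePoly, eval_finsetSum]
  refine sum_congr rfl fun k hk => ?_
  have hk' : k ≤ n := Nat.lt_succ_iff.mp (mem_range.mp hk)
  rw [← Nat.cast_sub hk', gbinom_natCast_s10, eval_monomial]
  ring

open Polynomial in
lemma natDegree_laguerrePoly_le (α : ℝ) (n : ℕ) : (laguerrePoly α n).natDegree ≤ n :=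
  natDegree_sum_le_of_forall_le _ _ fun _ hk =>
    (natDegree_monomial_le _).trans (Nat.lt_succ_iff.mp (mem_range.mp hk))

open Polynomial in
lemma iterate_derivative_laguerrePoly_eval_zero (α : ℝ) {n k : ℕ} (hk : k ≤ n) :
    (derivative^[k] (laguerrePoly α n)).eval 0
      = (-1) ^ k * Ring.choose ((n : ℝ) + α) (n - k) := by
  have hc : (laguerrePoly α n).coeff k
      = (-1) ^ k * Ring.choose ((n : ℝ) + α) (n - k) / (k.factorial : ℝ) := by
    simp only [laguerrePoly, finsetSum_coeff, coeff_monomial]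
    rw [sum_ite_eq' , if_pos (mem_range.mpr (Nat.lt_succ_of_le hk))]
  rw [← coeff_zero_eq_eval_zero, coeff_iterate_derivative, zero_add, hc, Nat.descFactorial_self,
    nsmul_eq_mul, mul_div_cancel₀ _ (by positivity)]

open Polynomial in
lemma tsum_bStar_mul_iteratedDeriv_laguerre (α x : ℝ) {n k : ℕ} (hk : k ≤ n) :
    ∑' i : ℕ, bStar α i x * iteratedDeriv (i + k) (laguerre α n) x
      = (-1) ^ k * Ring.choose ((n : ℝ) - 1) (n - k) := by
  simp only [laguerre_eq_eval, iteratedDeriv_polynomial_eval, Function.iterate_add_apply]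
  have hdeg : (derivative^[k] (laguerrePoly α n)).natDegree < n - k + 1 := by
    have := natDegree_iterate_derivative (laguerrePoly α n) k
    have := natDegree_laguerrePoly_le α n
    omega
  rw [tsum_bStar_mul_iterate_derivative_eval α x _ hdeg,
    show (n : ℝ) - 1 = -(α + 1) + (n + α) by ring, Ring.add_choose_eq _ (Commute.all _ _),
    Nat.sum_antidiagonal_eq_sum_range_succ_mk, mul_sum]
  refine sum_congr rfl fun m hm => ?_
  have hm' : m ≤ n - k := Nat.lt_succ_iff.mp (mem_range.mp hm)
  rw [← Function.iterate_add_apply, iterate_derivative_laguerrePoly_eval_zero α (by omega),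
    poch_div_factorial, show n - (m + k) = n - k - m by omega, pow_add]
  have h : ((-1 : ℝ) ^ m) * (-1) ^ m = 1 := by rw [← mul_pow]; simp
  linear_combination (Ring.choose (-(α + 1)) m * Ring.choose ((n : ℝ) + α) (n - k - m) *
    (-1) ^ k) * h

/-- `∑_{i=0}^∞ b_i^*(α,x) D^{i+k} L_n^α(x)` equals `0, -1, n-1` for `k = 0, 1, 2`
(i.e. it equals `(-n)_k / (n Γ(k))` with `1/Γ(0) = 0`). -/
theorem statement10 (α : ℝ) (hα : -1 < α) (n : ℕ) (hn : 1 ≤ n) (k : ℕ) (hk : k ≤ 2) (x : ℝ) :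
    ∑' i : ℕ, bStar α i x * iteratedDeriv (i + k) (laguerre α n) x
      = if k = 0 then 0 else if k = 1 then -1 else (n : ℝ) - 1 := by
  obtain ⟨p, rfl⟩ := Nat.exists_eq_add_of_le' hn
  have hp : ((p + 1 : ℕ) : ℝ) - 1 = p := by push_cast; ring
  by_cases hkn : k ≤ p + 1
  · rw [tsum_bStar_mul_iteratedDeriv_laguerre α x hkn, hp, Ring.choose_natCast]
    interval_cases k
    · simp
    · simp
    · obtain ⟨q, rfl⟩ := Nat.exists_eq_add_of_le' (show 1 ≤ p by omega)
      simp
  · obtain rfl : k = 2 := by omega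
    obtain rfl : p = 0 := by omega
    have h : ∀ i, Polynomial.derivative^[i + 2] (laguerrePoly α (0 + 1)) = 0 := fun i =>
      Polynomial.iterate_derivative_eq_zero (by
        have := natDegree_laguerrePoly_le α (0 + 1)
        omega)
    simp [laguerre_eq_eval, iteratedDeriv_polynomial_eval, h]
end
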